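/- For any even m and any k ≥ 1, the class of pointwise maxima (unions) of k functions each alternating at most m times equals the class of functions alternating at most mk times: A_m^{∪k} = A_{mk}. -/

import Mathlib

def AltAtMost (m : ℕ) (f : ℝ → Bool) : Prop :=
  ∀ x : Fin (m + 2) → ℝ, StrictMono x →
    ∃ i : Fin (m + 1), f (x i.castSucc) = f (x i.succ)

def AltClass (m : ℕ) : Set (ℝ → Bool) := {f | AltAtMost m f}

/-- The class of pointwise ORs (unions) of `k` functions from `H`. -/
def UnionClass {X : Type*} (k : ℕ) (H : Set (X → Bool)) : Set (X → Bool) :=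
  {f | ∃ g : Fin k → (X → Bool), (∀ i, g i ∈ H) ∧ ∀ x, f x = true ↔ ∃ i, g i x = true}

def AChain (f : ℝ → Bool) (n : ℕ) (y : ℕ → ℝ) : Prop :=
  ∀ i < n, y i < y (i + 1) ∧ f (y i) ≠ f (y (i + 1))

theorem AChain.le {f : ℝ → Bool} {m n : ℕ} {y : ℕ → ℝ} (hf : AltAtMost m f)
    (h : AChain f n y) : n ≤ m := by
  by_contra hn
  have hs : StrictMono (fun i : Fin (m + 2) => y i.val) := by
    rw [Fin.strictMono_iff_lt_succ]
    intro i
    have := i.2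
    exact (h i.val (by omega)).1
  obtain ⟨i, hi⟩ := hf _ hs
  have := i.2
  exact (h i.val (by omega)).2 hi

theorem AChain.val {f : ℝ → Bool} {n : ℕ} {y : ℕ → ℝ} (h : AChain f n y) :
    ∀ i ≤ n, f (y i) = xor (f (y 0)) (decide (Odd i)) := by
  intro i
  induction i with
  | zero => simp
  | succ i ih =>
    intro hi
    have h1 := ih (by omega)
    have h2 := (h i (by omega)).2
    rw [h1] at h2
    by_cases ho : Odd i <;> simp [ho, Nat.odd_add_one] at h2 ⊢ <;>
      cases hA : f (y 0) <;> cases hB : f (y (i + 1)) <;> simp_all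

/-- rank function of an alternating function -/
theorem exists_rank {m : ℕ} {f : ℝ → Bool} (hf : AltAtMost m f) :
    ∃ (b : Bool) (c : ℝ → ℕ), Monotone c ∧ (∀ x, c x ≤ m) ∧
      ∀ x, f x = xor b (decide (Odd (c x))) := by
  classical
  have key : ∀ x : ℝ, ∃ n, (∃ y, AChain f n y ∧ y n ≤ x) ∧
      ∀ n', (∃ y, AChain f n' y ∧ y n' ≤ x) → n' ≤ n := by
    intro x
    let P : ℕ → Prop := fun n => ∃ y, AChain f n y ∧ y n ≤ x
    have h0 : P 0 := ⟨fun _ => x, by intro i hi; omega, le_refl _⟩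
    refine ⟨Nat.findGreatest P m, ?_, ?_⟩
    · exact Nat.findGreatest_spec (P := P) (Nat.zero_le m) h0
    · rintro n' ⟨y, hy, hyx⟩
      exact Nat.le_findGreatest (hy.le hf) ⟨y, hy, hyx⟩
  choose c hc hmax using key
  choose y hy hyx using hc
  have hend : ∀ x, f x = f (y x (c x)) := by
    intro x
    by_contra hne
    have hlt : y x (c x) < x := by
      refine lt_of_le_of_ne (hyx x) ?_
      intro h; rw [h] at hne; exact hne rfl
    have := hmax x (c x + 1) ⟨fun i => if i ≤ c x then y x i else x, by
      intro i hi
      by_cases h : i < c x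
      · have h1 : i ≤ c x := by omega
        have h2 : i + 1 ≤ c x := by omega
        simp only [h1, h2, if_true]
        exact hy x i h
      · have h1 : i = c x := by omega
        subst h1
        simp only [le_refl, if_true, Nat.not_succ_le_self, if_false]
        exact ⟨hlt, fun h => hne h.symm⟩, by simp⟩
    omega
  have hstart : ∀ x x', y x 0 < y x' 0 → f (y x 0) = f (y x' 0) := by
    intro x x' hlt
    by_contra hne
    have := hmax x' (c x' + 1) ⟨fun i => if i = 0 then y x 0 else y x' (i - 1), by
      intro i hi
      rcases i with _ | i
      · simpa using ⟨hlt, hne⟩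
      · simpa using hy x' i (by omega), by simpa using hyx x'⟩
    omega
  have hstart' : ∀ x x', f (y x 0) = f (y x' 0) := by
    intro x x'
    rcases lt_trichotomy (y x 0) (y x' 0) with h | h | h
    · exact hstart _ _ h
    · rw [h]
    · exact (hstart _ _ h).symm
  refine ⟨f (y 0 0), c, ?_, fun x => (hy x).le hf, ?_⟩
  · intro x x' hxx
    exact hmax x' (c x) ⟨y x, hy x, (hyx x).trans hxx⟩
  · intro x
    rw [hend x, (hy x).val _ le_rfl, hstart' x 0]

theorem exists_step (G : ℕ → Bool) (a b : ℕ) (hab : a ≤ b) (h : G a ≠ G b) :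
    ∃ n, a ≤ n ∧ n < b ∧ G n ≠ G (n + 1) := by
  induction b, hab using Nat.le_induction with
  | base => exact absurd rfl h
  | succ b hb ih =>
    by_cases hh : G a = G b
    · exact ⟨b, hb, by omega, hh ▸ h⟩
    · obtain ⟨n, h1, h2, h3⟩ := ih hh
      exact ⟨n, h1, by omega, h3⟩

theorem alt_of_steps {m N : ℕ} (c : ℝ → ℕ) (hc : Monotone c) (hN : ∀ x, c x ≤ N)
    (G : ℕ → Bool) (D : Finset ℕ) (hD : ∀ n < N, G n ≠ G (n + 1) → n ∈ D) (hcard : D.card ≤ m) :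
    AltAtMost m (fun x => G (c x)) := by
  intro x hx
  by_contra hcon
  push Not at hcon
  have := fun i : Fin (m + 1) => exists_step G (c (x i.castSucc)) (c (x i.succ))
    (hc (hx.monotone (Fin.castSucc_lt_succ).le)) (hcon i)
  choose s h1 h2 h3 using this
  have hs : StrictMono s := by
    intro i j hij
    have h4 : c (x i.succ) ≤ c (x j.castSucc) := by
      apply hc; apply hx.monotone
      exact Fin.succ_le_castSucc_iff.mpr hij
    have := h1 j; have := h2 i; omega
  have : (Finset.univ : Finset (Fin (m + 1))).card ≤ D.card := by
    apply Finset.card_le_card_of_injOn s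
    · intro i _
      exact hD _ (lt_of_lt_of_le (h2 i) (hN _)) (h3 i)
    · exact hs.injective.injOn
  simp at this
  omega

/-- For even `m` and `k ≥ 1`, the class of unions of `k` functions alternating
at most `m` times equals the class of functions alternating at most `mk` times. -/
theorem union_of_alternating (m k : ℕ) (hm : Even m) (hk : 1 ≤ k) :
    UnionClass k (AltClass m) = AltClass (m * k) := by
  classical
  ext f
  constructor
  · rintro ⟨g, hg, hf⟩ x hx
    by_contra hcon
    push Not at hcon
    have hch : ∀ i : Fin (m * k + 1), ∃ j, g j (x i.castSucc) ≠ g j (x i.succ) := by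
      intro i
      by_contra hall
      push Not at hall
      apply hcon i
      rw [Bool.eq_iff_iff, hf, hf]
      simp [hall]
    choose J hJ using hch
    choose b c hmono hle hval using fun j => exists_rank (hg j)
    have hlt : ∀ i, c (J i) (x i.castSucc) < c (J i) (x i.succ) := by
      intro i
      refine lt_of_le_of_ne (hmono _ (hx.monotone (Fin.castSucc_lt_succ).le)) ?_
      intro h
      apply hJ i
      rw [hval, hval, h]
    have hinj : Function.Injective
        (fun i => ((J i, ⟨c (J i) (x i.castSucc), lt_of_lt_of_le (hlt i) (hle _ _)⟩) :
          Fin k × Fin m)) := by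
      have aux : ∀ i i', i < i' → J i = J i' →
          c (J i) (x i.castSucc) < c (J i') (x i'.castSucc) := by
        intro i i' h hJJ
        refine lt_of_lt_of_le (hlt i) ?_
        rw [hJJ]
        exact hmono _ (hx.monotone (Fin.succ_le_castSucc_iff.mpr h))
      intro i i' h
      simp only [Prod.mk.injEq, Fin.mk.injEq] at h
      rcases lt_trichotomy i i' with h' | h' | h'
      · have := aux _ _ h' h.1; omega
      · exact h'
      · have := aux _ _ h' h.1.symm; omega
    have := Fintype.card_le_of_injective _ hinj
    simp at this
    rw [mul_comm] at this
    omega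
  · intro hf
    rcases Nat.eq_zero_or_pos m with rfl | hmpos
    · refine ⟨fun _ => f, fun _ => by simpa using hf, fun x => ?_⟩
      exact ⟨fun h => ⟨⟨0, hk⟩, h⟩, fun ⟨_, h⟩ => h⟩
    obtain ⟨b, c, hmono, hle, hval⟩ := exists_rank hf
    let S : ℕ → ℕ → Prop := fun j n => (m * j ≤ n ∧ n < m * j + m) ∨ (j = 0 ∧ n = m * k)
    let G : ℕ → ℕ → Bool := fun j n => (xor b (decide (Odd n))) && decide (S j n)
    refine ⟨fun j x => G j (c x), ?_, ?_⟩
    · intro j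
      have hjk : m * j.val + m ≤ m * k := by
        have := j.2
        calc m * j.val + m = m * (j.val + 1) := by ring
          _ ≤ m * k := Nat.mul_le_mul_left _ this
      have hev : Even (m * j.val) := hm.mul_right _
      have hevk : Even (m * k) := hm.mul_right _
      have h0 : j.val = 0 → m * j.val = 0 := by intro h; rw [h]; simp
      have h0' : j.val ≠ 0 → m ≤ m * j.val := fun h =>
        Nat.le_mul_of_pos_right _ (Nat.pos_of_ne_zero h)
      let D : Finset ℕ := if b = false then Finset.Ico (m * j.val) (m * j.val + m) else
        if j.val = 0 then insert (m * k - 1) (Finset.range (m - 1)) else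
          Finset.Ico (m * j.val - 1) (m * j.val + m - 1)
      refine alt_of_steps c hmono hle (G j) D ?_ ?_
      · intro n hn hne
        simp only [G, S, D] at hne ⊢
        generalize m * j.val = A at *
        generalize m * k = B at *
        by_contra hnD
        apply hne
        rw [Bool.eq_iff_iff]
        cases b
        · simp at hnD ⊢
          simp only [Nat.odd_iff, Nat.even_iff] at *
          omega
        · by_cases hj : j.val = 0 <;> simp [hj] at hnD ⊢ <;>
          simp only [Nat.odd_iff, Nat.even_iff] at * <;> omega
      · simp only [D]
        split_ifs
        · simp
        · refine (Finset.card_insert_le _ _).trans ?_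
          simp; omega
        · simp; omega
    · intro x
      constructor
      · intro h
        rw [hval] at h
        rcases (hle x).lt_or_eq with hlt | heq
        · refine ⟨⟨c x / m, Nat.div_lt_of_lt_mul hlt⟩, ?_⟩
          simp only [G, h, S, Bool.true_and, decide_eq_true_eq]
          left
          have := Nat.div_add_mod (c x) m
          have := Nat.mod_lt (c x) hmpos
          omega
        · refine ⟨⟨0, hk⟩, ?_⟩
          simp only [G, h, S, Bool.true_and, decide_eq_true_eq]
          right
          exact ⟨trivial, heq⟩
      · rintro ⟨j, h⟩
        rw [hval]
        simp only [G, Bool.and_eq_true] at h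
        exact h.1
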